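/- Let (Ω, F, (F_t)_{t≥0}, P) be a filtered probability space satisfying the usual conditions. The optional projection operator is an averaging operator on L_op: if X, Y ∈ L_op and Y·(^oX) ∈ L_op, then ^o(Y·(^oX)) = (^oY)·(^oX) up to indistinguishability. -/

import Mathlib

open MeasureTheory Filter
open scoped ENNReal NNReal

/-- A random variable `ξ` is σ-integrable with respect to the sub-σ-field `G` if there is a
sequence of sets `s n ∈ G` increasing to `Ω` such that `ξ · 1_{s n}` is integrable for each `n`. -/
def SigmaIntegrable {Ω : Type*} {mΩ : MeasurableSpace Ω} (μ : Measure Ω)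
    (G : MeasurableSpace Ω) (ξ : Ω → ℝ) : Prop :=
  ∃ s : ℕ → Set Ω, (∀ n, MeasurableSet[G] (s n)) ∧ Monotone s ∧
    (⋃ n, s n) = Set.univ ∧ ∀ n, Integrable ((s n).indicator ξ) μ

/-- `η` is (a version of) the generalized conditional expectation `E[ξ ∣ G]`:  `η` is
`G`-measurable and `E[ξ · 1_A] = E[η · 1_A]` for every `A ∈ G` such that `ξ · 1_A` is
integrable. -/
def IsGCE {Ω : Type*} {mΩ : MeasurableSpace Ω} (μ : Measure Ω)
    (G : MeasurableSpace Ω) (ξ η : Ω → ℝ) : Prop :=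
  Measurable[G] η ∧ ∀ A : Set Ω, MeasurableSet[G] A → Integrable (A.indicator ξ) μ →
    ∫ ω, A.indicator ξ ω ∂μ = ∫ ω, A.indicator η ω ∂μ

noncomputable section

/-- The stopped value `X_T · 1_{[T<∞]}` of a process `X` at the `[0,∞]`-valued random time `T`. -/
def stoppedVal {Ω : Type*} (X : ℝ≥0 → Ω → ℝ) (T : Ω → ℝ≥0∞) : Ω → ℝ :=
  {ω | T ω < ∞}.indicator fun ω => X (T ω).toNNReal ω

/-- `T` is a stopping time of the filtration `ℱ`: `[T ≤ t] ∈ ℱ t` for all `t ≥ 0`. -/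
def IsStopTime {Ω : Type*} [mΩ : MeasurableSpace Ω] (ℱ : Filtration ℝ≥0 mΩ)
    (T : Ω → ℝ≥0∞) : Prop :=
  ∀ t : ℝ≥0, MeasurableSet[ℱ t] {ω | T ω ≤ (t : ℝ≥0∞)}

/-- The σ-field `F_T` of events prior to the stopping time `T`:
`F_T = {A ∈ F_∞ ∣ A ∩ [T ≤ t] ∈ ℱ t for all t ≥ 0}`. -/
def sigmaAt {Ω : Type*} [mΩ : MeasurableSpace Ω] (ℱ : Filtration ℝ≥0 mΩ) (T : Ω → ℝ≥0∞)
    (hT : IsStopTime ℱ T) : MeasurableSpace Ω where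
  MeasurableSet' A := MeasurableSet[⨆ t : ℝ≥0, (ℱ t : MeasurableSpace Ω)] A ∧
    ∀ t : ℝ≥0, MeasurableSet[ℱ t] (A ∩ {ω | T ω ≤ (t : ℝ≥0∞)})
  measurableSet_empty :=
    ⟨@MeasurableSet.empty Ω (⨆ t : ℝ≥0, (ℱ t : MeasurableSpace Ω)), fun t => by simp⟩
  measurableSet_compl A hA := ⟨hA.1.compl, fun t => by
    have h : Aᶜ ∩ {ω | T ω ≤ (t : ℝ≥0∞)} =
        {ω | T ω ≤ (t : ℝ≥0∞)} \ (A ∩ {ω | T ω ≤ (t : ℝ≥0∞)}) := by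
      ext ω; by_cases hω : T ω ≤ (t : ℝ≥0∞) <;> simp [hω]
    rw [h]
    exact (hT t).diff (hA.2 t)⟩
  measurableSet_iUnion f hf := ⟨MeasurableSet.iUnion fun i => (hf i).1, fun t => by
    rw [Set.iUnion_inter]
    exact MeasurableSet.iUnion fun i => (hf i).2 t⟩

/-- The usual conditions: the filtration is right-continuous and `ℱ 0` contains all `μ`-null
measurable sets. -/
def UsualConditions {Ω : Type*} [mΩ : MeasurableSpace Ω] (μ : Measure Ω)
    (ℱ : Filtration ℝ≥0 mΩ) : Prop :=
  (∀ t : ℝ≥0, (ℱ t : MeasurableSpace Ω) = ⨅ (s : ℝ≥0) (_ : t < s), (ℱ s : MeasurableSpace Ω)) ∧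
  (∀ N : Set Ω, MeasurableSet N → μ N = 0 → MeasurableSet[ℱ 0] N)

/-- The optional σ-field on `ℝ≥0 × Ω`, generated by all càdlàg adapted processes. -/
def optionalSigma {Ω : Type*} [mΩ : MeasurableSpace Ω] (ℱ : Filtration ℝ≥0 mΩ) :
    MeasurableSpace (ℝ≥0 × Ω) :=
  ⨆ X ∈ {X : ℝ≥0 → Ω → ℝ |
      (∀ ω, ∀ t : ℝ≥0, ContinuousWithinAt (fun s => X s ω) (Set.Ici t) t) ∧
      (∀ ω, ∀ t : ℝ≥0, 0 < t →
        ∃ l : ℝ, Filter.Tendsto (fun s => X s ω) (nhdsWithin t (Set.Iio t)) (nhds l)) ∧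
      (∀ t, Measurable[ℱ t] (X t))},
    MeasurableSpace.comap (fun p : ℝ≥0 × Ω => X p.1 p.2) (borel ℝ)

/-- A process is optional if it is measurable with respect to the optional σ-field. -/
def IsOptional {Ω : Type*} [mΩ : MeasurableSpace Ω] (ℱ : Filtration ℝ≥0 mΩ)
    (Y : ℝ≥0 → Ω → ℝ) : Prop :=
  Measurable[optionalSigma ℱ] fun p : ℝ≥0 × Ω => Y p.1 p.2

/-- A measurable process. -/
def MeasurableProcess {Ω : Type*} [mΩ : MeasurableSpace Ω] (X : ℝ≥0 → Ω → ℝ) : Prop :=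
  Measurable fun p : ℝ≥0 × Ω => X p.1 p.2

/-- Membership in `L_op`: `X` is a measurable process such that `X_T · 1_{[T<∞]}` is σ-integrable
with respect to `F_T` for every stopping time `T`. -/
def MemLop {Ω : Type*} [mΩ : MeasurableSpace Ω] (μ : Measure Ω) (ℱ : Filtration ℝ≥0 mΩ)
    (X : ℝ≥0 → Ω → ℝ) : Prop :=
  MeasurableProcess X ∧
  ∀ (T : Ω → ℝ≥0∞) (hT : IsStopTime ℱ T),
    SigmaIntegrable μ (sigmaAt ℱ T hT) (stoppedVal X T)

/-- Indistinguishability of two processes (equality up to evanescence). -/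
def Indist {Ω : Type*} [mΩ : MeasurableSpace Ω] (μ : Measure Ω)
    (X Y : ℝ≥0 → Ω → ℝ) : Prop :=
  ∀ᵐ ω ∂μ, ∀ t, X t ω = Y t ω

/-- `Y` is an optional projection of `X`: `Y` is optional and, for every stopping time `T`,
`E[X_T · 1_{[T<∞]} ∣ F_T] = Y_T · 1_{[T<∞]}` a.s., with generalized conditional expectations. -/
def IsOptProj {Ω : Type*} [mΩ : MeasurableSpace Ω] (μ : Measure Ω) (ℱ : Filtration ℝ≥0 mΩ)
    (X Y : ℝ≥0 → Ω → ℝ) : Prop :=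
  IsOptional ℱ Y ∧
  ∀ (T : Ω → ℝ≥0∞) (hT : IsStopTime ℱ T),
    ∃ η, IsGCE μ (sigmaAt ℱ T hT) (stoppedVal X T) η ∧ η =ᵐ[μ] stoppedVal Y T

theorem cap_aux {E F : Type*} [TopologicalSpace E] [TopologicalSpace F] [MeasurableSpace F]
    [BorelSpace F] (ν : Measure F) [ν.OuterRegular] {A : Set E} (hA : AnalyticSet A)
    (p : E → F) (hp : Continuous p) {c : ℝ≥0∞} (hc : c < ν (p '' A)) :
    ∃ K ⊆ A, IsCompact K ∧ c ≤ ν (p '' K) := by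
  rw [AnalyticSet] at hA
  rcases hA with rfl | ⟨g, hg, rfl⟩
  · simp at hc
  have hq : Continuous (p ∘ g) := hp.comp hg
  set q := p ∘ g with hqdef
  rw [← Set.range_comp, ← hqdef, ← Set.image_univ] at hc
  have step : ∀ (n : ℕ) (S : Set (ℕ → ℕ)), c < ν (q '' S) →
      ∃ k : ℕ, c < ν (q '' (S ∩ {σ | σ n ≤ k})) := by
    intro n S hS
    have hU : q '' S = ⋃ k : ℕ, q '' (S ∩ {σ | σ n ≤ k}) := by
      rw [← Set.image_iUnion, ← Set.inter_iUnion]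
      congr 1
      ext σ
      simp only [Set.mem_inter_iff, Set.mem_iUnion, Set.mem_ofPred_eq]
      exact ⟨fun h => ⟨h, _, le_rfl⟩, fun h => h.1⟩
    have hmono : Monotone fun k : ℕ => q '' (S ∩ {σ | σ n ≤ k}) := by
      intro a b hab
      apply Set.image_mono
      rintro σ ⟨h1, h2⟩
      exact ⟨h1, le_trans h2 hab⟩
    rw [hU, hmono.measure_iUnion] at hS
    exact lt_iSup_iff.1 hS
  choose K hK using step
  let S : ℕ → {S : Set (ℕ → ℕ) // c < ν (q '' S)} := fun n =>
    Nat.rec ⟨Set.univ, hc⟩ (fun n S => ⟨S.1 ∩ {σ | σ n ≤ K n S.1 S.2}, hK n S.1 S.2⟩) n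
  let k : ℕ → ℕ := fun n => K n (S n).1 (S n).2
  have hS : ∀ n, (S n).1 = {σ | ∀ i < n, σ i ≤ k i} := by
    intro n
    induction n with
    | zero => ext σ; simp [S]
    | succ n ih =>
      have : (S (n+1)).1 = (S n).1 ∩ {σ | σ n ≤ k n} := rfl
      rw [this, ih]
      ext σ
      simp only [Set.mem_inter_iff, Set.mem_ofPred_eq, Nat.lt_succ_iff]
      constructor
      · rintro ⟨h1, h2⟩ i hi
        rcases hi.lt_or_eq with h | rfl
        · exact h1 i h
        · exact h2
      · intro h
        exact ⟨fun i hi => h i hi.le, h n le_rfl⟩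
  let L : Set (ℕ → ℕ) := Set.pi Set.univ fun i => Set.Iic (k i)
  have hL : IsCompact L := isCompact_univ_pi fun i => (Set.finite_Iic (k i)).isCompact
  refine ⟨g '' L, Set.image_subset_range _ _, hL.image hg, ?_⟩
  rw [← Set.image_comp, ← hqdef]
  by_contra! hlt
  obtain ⟨O, hLO, hO, hOc⟩ := Set.exists_isOpen_lt_of_lt _ _ hlt
  have key : ∀ n, ∃ σ ∈ (S n).1, q σ ∉ O := by
    intro n
    by_contra! h
    have : ν (q '' (S n).1) ≤ ν O := measure_mono (by rintro _ ⟨σ, hσ, rfl⟩; exact h σ hσ)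
    exact absurd ((S n).2.trans_le this) hOc.not_gt
  choose σ hσS hσO using key
  obtain ⟨τ, hτ, φ, hφ, hlim⟩ := hL.tendsto_subseq (x := fun n i => min (σ n i) (k i))
    (fun n i _ => Set.mem_Iic.2 (min_le_right _ _))
  have hlim2 : Tendsto (fun n => σ (φ n)) atTop (nhds τ) := by
    rw [tendsto_pi_nhds] at hlim ⊢
    intro i
    refine (hlim i).congr' ?_
    filter_upwards [eventually_gt_atTop i] with n hn
    have := hσS (φ n)
    rw [hS] at this
    exact min_eq_left (this i (hn.trans_le hφ.le_apply))
  have : τ ∈ (q ⁻¹' O)ᶜ := ((hO.preimage hq).isClosed_compl).mem_of_tendsto hlim2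
    (Eventually.of_forall fun n => hσO _)
  exact this (hLO ⟨τ, hτ, rfl⟩)

theorem reduce_aux {Ω : Type*} (G : MeasurableSpace Ω) {A : Set (ℝ≥0 × Ω)}
    (hA : MeasurableSet A) :
    ∃ f : Ω → (ℕ → Bool), Measurable f ∧ ∃ A' : Set (ℝ≥0 × (ℕ → Bool)), MeasurableSet A' ∧
      A = (fun p : ℝ≥0 × Ω => (p.1, f p.2)) ⁻¹' A' := by
  let M : MeasurableSpace (ℝ≥0 × Ω) :=
    { MeasurableSet' := fun A => ∃ f : Ω → (ℕ → Bool), Measurable f ∧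
        ∃ A' : Set (ℝ≥0 × (ℕ → Bool)), MeasurableSet A' ∧
          A = (fun p : ℝ≥0 × Ω => (p.1, f p.2)) ⁻¹' A'
      measurableSet_empty := ⟨fun _ _ => false, measurable_const, ∅, MeasurableSet.empty, rfl⟩
      measurableSet_compl := by
        rintro _ ⟨f, hf, A', hA', rfl⟩
        exact ⟨f, hf, A'ᶜ, hA'.compl, rfl⟩
      measurableSet_iUnion := by
        intro s hs
        choose f hf A' hA' h using hs
        refine ⟨fun ω n => f n.unpair.1 ω n.unpair.2, ?_,
          ⋃ i, (fun p : ℝ≥0 × (ℕ → Bool) => (p.1, fun j => p.2 (Nat.pair i j))) ⁻¹' A' i, ?_, ?_⟩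
        · rw [measurable_pi_iff]
          intro n
          exact (measurable_pi_apply _).comp (hf _)
        · refine MeasurableSet.iUnion fun i => (hA' i).preimage ?_
          refine measurable_fst.prodMk ?_
          rw [measurable_pi_iff]
          intro j
          exact (measurable_pi_apply _).comp measurable_snd
        · rw [Set.preimage_iUnion]
          refine Set.iUnion_congr fun i => ?_
          rw [h i]
          ext p
          simp }
  have hle : (Prod.instMeasurableSpace : MeasurableSpace (ℝ≥0 × Ω)) ≤ M := by
    refine sup_le (α := MeasurableSpace (ℝ≥0 × Ω)) ?_ ?_
    · rintro _ ⟨s, hs, rfl⟩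
      exact ⟨fun _ _ => false, measurable_const, Prod.fst ⁻¹' s, measurable_fst hs, rfl⟩
    · rintro _ ⟨s, hs, rfl⟩
      classical
      refine ⟨fun ω _ => decide (ω ∈ s), ?_, {p | p.2 0 = true}, ?_, ?_⟩
      · rw [measurable_pi_iff]
        intro _
        refine measurable_to_bool ?_
        convert hs using 1
        ext ω
        simp
      · have hm : Measurable fun p : ℝ≥0 × (ℕ → Bool) => p.2 0 :=
          (measurable_pi_apply 0).comp measurable_snd
        exact hm (measurableSet_singleton true)
      · ext p
        simp
  exact hle _ hA

theorem compact_debut {C : Type*} [TopologicalSpace C] [T2Space C] [MeasurableSpace C]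
    [BorelSpace C] {K : Set (ℝ≥0 × C)} (hK : IsCompact K) :
    ∃ d : C → ℝ≥0∞, Measurable d ∧ (∀ x, d x < ∞ → ((d x).toNNReal, x) ∈ K) ∧
      {x | d x < ∞} = Prod.snd '' K := by
  classical
  let F : C → Set ℝ≥0 := fun x => {s | (s, x) ∈ K}
  have hF : ∀ x, IsCompact (F x) := by
    intro x
    have : F x = Prod.fst '' (K ∩ {p | p.2 = x}) := by
      ext s
      constructor
      · intro h
        exact ⟨(s, x), ⟨h, rfl⟩, rfl⟩
      · rintro ⟨⟨s, y⟩, ⟨h, rfl⟩, rfl⟩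
        exact h
    rw [this]
    exact (hK.inter_right (isClosed_singleton.preimage continuous_snd)).image continuous_fst
  let d : C → ℝ≥0∞ := fun x => if (F x).Nonempty then ((sInf (F x) : ℝ≥0) : ℝ≥0∞) else ∞
  have hd : ∀ x, d x < ∞ ↔ (F x).Nonempty := by
    intro x
    by_cases h : (F x).Nonempty <;> simp [d, h]
  refine ⟨d, ?_, ?_, ?_⟩
  · refine measurable_of_Iic fun a => ?_
    induction a using ENNReal.recTopCoe with
    | top => simp
    | coe a =>
      have : d ⁻¹' Set.Iic (a : ℝ≥0∞) = Prod.snd '' (K ∩ {p | p.1 ≤ a}) := by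
        ext x
        by_cases h : (F x).Nonempty
        · have hm := (hF x).sInf_mem h
          simp only [d, h, if_true, Set.mem_preimage, Set.mem_Iic, ENNReal.coe_le_coe]
          constructor
          · intro h'
            exact ⟨(_, x), ⟨hm, h'⟩, rfl⟩
          · rintro ⟨⟨s, y⟩, ⟨h1, h2⟩, rfl⟩
            exact (csInf_le (OrderBot.bddBelow (F y)) (show s ∈ F y from h1)).trans h2
        · simp only [d, h, if_false, Set.mem_preimage, Set.mem_Iic]
          constructor
          · intro h'
            simp at h'
          · rintro ⟨⟨s, y⟩, ⟨h1, h2⟩, rfl⟩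
            exact absurd ⟨s, h1⟩ h
      rw [this]
      exact ((hK.inter_right (isClosed_Iic.preimage continuous_fst)).image
        continuous_snd).isClosed.measurableSet
  · intro x hx
    have h := (hd x).1 hx
    simp only [d, h, if_true, ENNReal.toNNReal_coe]
    exact (hF x).sInf_mem h
  · ext x
    rw [Set.mem_ofPred_eq, hd]
    constructor
    · rintro ⟨s, hs⟩
      exact ⟨_, hs, rfl⟩
    · rintro ⟨⟨s, y⟩, h1, rfl⟩
      exact ⟨s, h1⟩

theorem meas_section {Ω : Type*} (G : MeasurableSpace Ω) {mΩ : MeasurableSpace Ω} (μ : Measure Ω)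
    [IsFiniteMeasure μ] (hG : G ≤ mΩ) {A : Set (ℝ≥0 × Ω)}
    (hA : MeasurableSet[@Prod.instMeasurableSpace _ _ _ G] A) {c : ℝ≥0∞}
    (hc : c < μ (Prod.snd '' A)) :
    ∃ R : Ω → ℝ≥0∞, Measurable[G] R ∧ (∀ ω, R ω < ∞ → ((R ω).toNNReal, ω) ∈ A) ∧
      c ≤ μ {ω | R ω < ∞} := by
  obtain ⟨f, hf, A', hA', rfl⟩ := @reduce_aux Ω G A hA
  have hf' : Measurable[mΩ] f := hf.mono hG le_rfl
  have h1 : Prod.snd '' ((fun p : ℝ≥0 × Ω => (p.1, f p.2)) ⁻¹' A') = f ⁻¹' (Prod.snd '' A') := by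
    ext ω
    constructor
    · rintro ⟨⟨s, y⟩, h, rfl⟩
      exact ⟨_, h, rfl⟩
    · rintro ⟨⟨s, y⟩, h, h2⟩
      refine ⟨(s, ω), ?_, rfl⟩
      simpa [← h2] using h
  rw [h1] at hc
  have h2 : c < (μ.map f) (Prod.snd '' A') :=
    hc.trans_le (Measure.le_map_apply hf'.aemeasurable _)
  have hP : PolishSpace ℝ≥0 := IsClosed.polishSpace (isClosed_Ici (a := (0 : ℝ)))
  have hB : PolishSpace Bool := {}
  have hP2 : PolishSpace (ℕ → Bool) := {}
  obtain ⟨K, hKA, hK, hcK⟩ := cap_aux (μ.map f) hA'.analyticSet Prod.snd continuous_snd h2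
  obtain ⟨d, hd, hdK, hdK'⟩ := compact_debut hK
  refine ⟨fun ω => d (f ω), hd.comp hf, fun ω hω => hKA (hdK _ hω), ?_⟩
  rw [← hdK', Measure.map_apply hf' (measurableSet_lt hd measurable_const)] at hcK
  exact hcK

theorem meas_proj {Ω : Type*} (G : MeasurableSpace Ω) {mΩ : MeasurableSpace Ω} (μ : Measure Ω)
    [IsFiniteMeasure μ] (hG : G ≤ mΩ) {A : Set (ℝ≥0 × Ω)}
    (hA : MeasurableSet[@Prod.instMeasurableSpace _ _ _ G] A) :
    ∃ E : Set Ω, MeasurableSet[G] E ∧ E ⊆ Prod.snd '' A ∧ μ (Prod.snd '' A \ E) = 0 := by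
  set H := Prod.snd '' A
  have h : ∀ c : ℝ≥0∞, c < μ H → ∃ E : Set Ω, MeasurableSet[G] E ∧ E ⊆ H ∧ c ≤ μ E := by
    intro c hc
    obtain ⟨R, hR, hRA, hcR⟩ := meas_section G μ hG hA hc
    exact ⟨{ω | R ω < ∞}, hR measurableSet_Iio,
      fun ω hω => ⟨_, hRA ω hω, rfl⟩, hcR⟩
  by_cases h0 : μ H = 0
  · exact ⟨∅, @MeasurableSet.empty _ G, Set.empty_subset _, by simpa using h0⟩
  obtain ⟨u, -, hu, hlim⟩ := exists_seq_strictMono_tendsto' (pos_iff_ne_zero.2 h0)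
  choose E hE hEH hEc using fun n => h (u n) (hu n).2
  refine ⟨⋃ n, E n, MeasurableSet.iUnion hE, Set.iUnion_subset hEH, ?_⟩
  have h3 : μ H ≤ μ (⋃ n, E n) :=
    le_of_tendsto' hlim fun n => (hEc n).trans (measure_mono (Set.subset_iUnion _ _))
  have hsub : (⋃ n, E n) ⊆ H := Set.iUnion_subset hEH
  have hm : MeasurableSet[mΩ] (⋃ n, E n) := hG _ (MeasurableSet.iUnion hE)
  rw [measure_sdiff hsub hm.nullMeasurableSet (measure_ne_top _ _)]
  exact tsub_eq_zero_of_le h3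

theorem rc_prog {Ω : Type*} [MeasurableSpace Ω] (X : ℝ≥0 → Ω → ℝ) (t : ℝ≥0)
    (hm : ∀ s ≤ t, Measurable (X s))
    (hc : ∀ ω, ∀ t : ℝ≥0, ContinuousWithinAt (fun s => X s ω) (Set.Ici t) t) :
    Measurable ({p : ℝ≥0 × Ω | p.1 < t}.indicator fun p => X p.1 p.2) := by
  have hI : MeasurableSet {p : ℝ≥0 × Ω | p.1 < t} := measurable_fst measurableSet_Iio
  let r : ℕ → ℕ → ℝ≥0 := fun n k => ((k : ℝ≥0) + 1) / ((n : ℝ≥0) + 1)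
  let e : ℕ → ℝ≥0 → ℝ≥0 := fun n s => r n ⌊((n : ℝ≥0) + 1) * s⌋₊
  have hr1 : ∀ n s, s ≤ e n s := by
    intro n s
    have hn : (0 : ℝ≥0) < (n : ℝ≥0) + 1 := by positivity
    simp only [e, r]
    rw [le_div_iff₀ hn, mul_comm]
    exact (Nat.lt_floor_add_one _).le
  have hr2 : ∀ n s, e n s ≤ s + 1 / ((n : ℝ≥0) + 1) := by
    intro n s
    have hn : (0 : ℝ≥0) < (n : ℝ≥0) + 1 := by positivity
    simp only [e, r]
    rw [div_le_iff₀ hn, add_mul s, div_mul_cancel₀ _ hn.ne', mul_comm s]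
    gcongr
    exact Nat.floor_le (by positivity)
  have hlim : ∀ s, Tendsto (fun n => e n s) atTop (nhds s) := by
    intro s
    refine tendsto_of_tendsto_of_tendsto_of_le_of_le tendsto_const_nhds ?_
      (fun n => hr1 n s) (fun n => hr2 n s)
    have := (tendsto_one_div_add_atTop_nhds_zero_nat (𝕜 := ℝ≥0)).const_add s
    simpa using this
  clear_value r
  refine measurable_of_tendsto_metrizable
    (f := fun n => {p : ℝ≥0 × Ω | p.1 < t}.indicator fun p => X (min t (e n p.1)) p.2) ?_ ?_
  · intro n
    refine Measurable.indicator ?_ hI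
    have h1 : Measurable fun q : ℕ × Ω => X (min t (r n q.1)) q.2 :=
      measurable_from_prod_countable_right fun k => hm (min t (r n k)) (min_le_left _ _)
    have h2 : Measurable fun p : ℝ≥0 × Ω => (⌊((n : ℝ≥0) + 1) * p.1⌋₊, p.2) :=
      (Nat.measurable_floor.comp (measurable_fst.const_mul _)).prodMk measurable_snd
    have h3 := h1.comp h2
    simpa only [e, Function.comp_def] using h3
  · rw [tendsto_pi_nhds]
    rintro ⟨s, ω⟩
    by_cases hs : s < t
    · have hmem : ((s, ω) : ℝ≥0 × Ω) ∈ {p : ℝ≥0 × Ω | p.1 < t} := hs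
      simp only [Set.indicator_of_mem hmem]
      have h3 : Tendsto (fun n => min t (e n s)) atTop (nhds s) := by
        have := (tendsto_const_nhds (x := t)).min (hlim s)
        rwa [min_eq_right hs.le] at this
      have h4 : Tendsto (fun n => min t (e n s)) atTop (nhdsWithin s (Set.Ici s)) :=
        tendsto_nhdsWithin_iff.2 ⟨h3, Eventually.of_forall fun n => le_min hs.le (hr1 n s)⟩
      exact (hc ω s).tendsto.comp h4
    · have hmem : ((s, ω) : ℝ≥0 × Ω) ∉ {p : ℝ≥0 × Ω | p.1 < t} := hs
      simp only [Set.indicator_of_notMem hmem]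
      exact tendsto_const_nhds

theorem opt_prog {Ω : Type*} [mΩ : MeasurableSpace Ω] (ℱ : Filtration ℝ≥0 mΩ) (t : ℝ≥0)
    {B : Set (ℝ≥0 × Ω)} (hB : MeasurableSet[optionalSigma ℱ] B) :
    MeasurableSet[@Prod.instMeasurableSpace _ _ _ (ℱ t)] (B ∩ {p | p.1 < t}) := by
  let P : MeasurableSpace (ℝ≥0 × Ω) := @Prod.instMeasurableSpace _ _ _ (ℱ t)
  have hI : MeasurableSet[P] {p : ℝ≥0 × Ω | p.1 < t} :=
    (@measurable_fst _ _ _ (ℱ t)) measurableSet_Iio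
  let M : MeasurableSpace (ℝ≥0 × Ω) :=
    { MeasurableSet' := fun B => MeasurableSet[P] (B ∩ {p | p.1 < t})
      measurableSet_empty := by
        rw [Set.empty_inter]
        exact @MeasurableSet.empty _ P
      measurableSet_compl := by
        intro B hB
        have : Bᶜ ∩ {p : ℝ≥0 × Ω | p.1 < t} =
            {p : ℝ≥0 × Ω | p.1 < t} \ (B ∩ {p : ℝ≥0 × Ω | p.1 < t}) := by
          ext p
          simp only [Set.mem_inter_iff, Set.mem_compl_iff, Set.mem_sdiff]
          tauto
        rw [this]
        exact hI.diff hB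
      measurableSet_iUnion := by
        intro s hs
        rw [Set.iUnion_inter]
        exact MeasurableSet.iUnion hs }
  have hle : optionalSigma ℱ ≤ M := by
    refine iSup₂_le ?_
    rintro X ⟨hc, -, ha⟩ _ ⟨s, hs, rfl⟩
    have h1 := @rc_prog Ω (ℱ t) X t (fun s hst => (ha s).mono (ℱ.mono hst) le_rfl) hc
    have h2 : MeasurableSet s := by
      rwa [BorelSpace.measurable_eq (α := ℝ)]
    have h3 := (h1 h2).inter hI
    change MeasurableSet[P] _
    convert h3 using 1
    ext p
    simp only [Set.mem_inter_iff, Set.mem_preimage]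
    constructor
    · rintro ⟨h4, h5⟩
      rw [Set.indicator_of_mem h5]
      exact ⟨h4, h5⟩
    · rintro ⟨h4, h5⟩
      rw [Set.indicator_of_mem h5] at h4
      exact ⟨h4, h5⟩
  exact hle _ hB

theorem opt_meas {Ω : Type*} [mΩ : MeasurableSpace Ω] (ℱ : Filtration ℝ≥0 mΩ)
    {B : Set (ℝ≥0 × Ω)} (hB : MeasurableSet[optionalSigma ℱ] B) : MeasurableSet B := by
  have : B = ⋃ n : ℕ, B ∩ {p | p.1 < (n : ℝ≥0)} := by
    rw [← Set.inter_iUnion]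
    ext p
    simp only [Set.mem_inter_iff, Set.mem_iUnion]
    exact ⟨fun h => ⟨h, exists_nat_gt p.1⟩, fun h => h.1⟩
  rw [this]
  refine MeasurableSet.iUnion fun n => ?_
  have h := opt_prog ℱ n hB
  refine (sup_le_sup le_rfl (MeasurableSpace.comap_mono (ℱ.le n)) :
    @Prod.instMeasurableSpace ℝ≥0 Ω _ (ℱ n) ≤ Prod.instMeasurableSpace) _ h

/-- Fibers closed under limits from the right. -/
def RC {Ω : Type*} (K : Set (ℝ≥0 × Ω)) : Prop :=
  ∀ ω t, (∃ᶠ s in nhdsWithin t (Set.Ici t), (s, ω) ∈ K) → (t, ω) ∈ K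

theorem RC.union {Ω : Type*} {K L : Set (ℝ≥0 × Ω)} (hK : RC K) (hL : RC L) : RC (K ∪ L) := by
  intro ω t h
  have h' : ∃ᶠ s in nhdsWithin t (Set.Ici t), (s, ω) ∈ K ∨ (s, ω) ∈ L := h
  rcases frequently_or_distrib.1 h' with h | h
  · exact Or.inl (hK ω t h)
  · exact Or.inr (hL ω t h)

theorem RC.iInter {Ω : Type*} {K : ℕ → Set (ℝ≥0 × Ω)} (hK : ∀ n, RC (K n)) :
    RC (⋂ n, K n) := by
  intro ω t h
  rw [Set.mem_iInter]
  intro n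
  exact hK n ω t (h.mono fun s hs => Set.mem_iInter.1 hs n)

/-- Inner approximable by right-closed optional sets. -/
def Apx {Ω : Type*} [mΩ : MeasurableSpace Ω] (ℱ : Filtration ℝ≥0 mΩ) (l : Measure (ℝ≥0 × Ω))
    (B : Set (ℝ≥0 × Ω)) : Prop :=
  ∀ ε : ℝ≥0∞, ε ≠ 0 → ∃ K ⊆ B, MeasurableSet[optionalSigma ℱ] K ∧ RC K ∧ l (B \ K) ≤ ε

theorem Apx.iUnion {Ω : Type*} [mΩ : MeasurableSpace Ω] (ℱ : Filtration ℝ≥0 mΩ)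
    (l : Measure (ℝ≥0 × Ω)) [IsFiniteMeasure l] {B : ℕ → Set (ℝ≥0 × Ω)}
    (hm : ∀ n, MeasurableSet (B n)) (h : ∀ n, Apx ℱ l (B n)) : Apx ℱ l (⋃ n, B n) := by
  intro ε hε
  obtain ⟨e, he, hsum⟩ := ENNReal.exists_pos_sum_of_countable' hε ℕ
  choose K hKB hKo hKr hKe using fun n => h n (e n) (he n).ne'
  have hacc : ∀ n, MeasurableSet[optionalSigma ℱ] (Set.accumulate K n) ∧
      RC (Set.accumulate K n) := by
    intro n
    induction n with
    | zero =>
      rw [show Set.accumulate K 0 = K 0 by simp [Set.accumulate]]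
      exact ⟨hKo 0, hKr 0⟩
    | succ n ih =>
      rw [Set.accumulate_succ]
      exact ⟨ih.1.union (hKo _), ih.2.union (hKr _)⟩
  have hlim : Tendsto (fun n => l ((⋃ n, B n) \ Set.accumulate K n)) atTop
      (nhds (l (⋂ n, (⋃ n, B n) \ Set.accumulate K n))) := by
    refine tendsto_measure_iInter_atTop (fun n => ?_) ?_ ⟨0, measure_ne_top _ _⟩
    · exact ((MeasurableSet.iUnion hm).diff (opt_meas ℱ (hacc n).1)).nullMeasurableSet
    · intro a b hab
      exact Set.sdiff_subset_sdiff_right (Set.monotone_accumulate hab)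
  have hlt : l (⋂ n, (⋃ n, B n) \ Set.accumulate K n) < ε := by
    refine lt_of_le_of_lt ?_ hsum
    refine (measure_mono ?_).trans ((measure_iUnion_le (fun n => B n \ K n)).trans
      (ENNReal.tsum_le_tsum hKe))
    intro p hp
    rw [Set.mem_iInter] at hp
    obtain ⟨n, hn⟩ := Set.mem_iUnion.1 (hp 0).1
    exact Set.mem_iUnion.2 ⟨n, hn, fun hk => (hp n).2 (Set.subset_accumulate hk)⟩
  obtain ⟨n, hn⟩ := (hlim.eventually_lt_const hlt).exists
  refine ⟨Set.accumulate K n, ?_, (hacc n).1, (hacc n).2, hn.le⟩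
  intro p hp
  obtain ⟨i, -, hi⟩ := Set.mem_accumulate.1 hp
  exact Set.mem_iUnion.2 ⟨i, hKB i hi⟩

theorem Apx.iInter {Ω : Type*} [mΩ : MeasurableSpace Ω] (ℱ : Filtration ℝ≥0 mΩ)
    (l : Measure (ℝ≥0 × Ω)) {B : ℕ → Set (ℝ≥0 × Ω)}
    (h : ∀ n, Apx ℱ l (B n)) : Apx ℱ l (⋂ n, B n) := by
  intro ε hε
  obtain ⟨e, he, hsum⟩ := ENNReal.exists_pos_sum_of_countable' hε ℕ
  choose K hKB hKo hKr hKe using fun n => h n (e n) (he n).ne'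
  refine ⟨⋂ n, K n, Set.iInter_mono hKB, MeasurableSet.iInter hKo, RC.iInter hKr, ?_⟩
  refine le_trans ?_ hsum.le
  refine (measure_mono ?_).trans ((measure_iUnion_le (fun n => B n \ K n)).trans
    (ENNReal.tsum_le_tsum hKe))
  rintro p ⟨hp, hp'⟩
  rw [Set.mem_iInter] at hp hp'
  push Not at hp'
  obtain ⟨n, hn⟩ := hp'
  exact Set.mem_iUnion.2 ⟨n, hp n, hn⟩

theorem opt_apx {Ω : Type*} [mΩ : MeasurableSpace Ω] (ℱ : Filtration ℝ≥0 mΩ)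
    (l : Measure (ℝ≥0 × Ω)) [IsFiniteMeasure l] {B : Set (ℝ≥0 × Ω)}
    (hB : MeasurableSet[optionalSigma ℱ] B) : Apx ℱ l B := by
  let M : MeasurableSpace (ℝ≥0 × Ω) :=
    { MeasurableSet' := fun B => MeasurableSet B ∧ Apx ℱ l B ∧ Apx ℱ l Bᶜ
      measurableSet_empty := by
        refine ⟨MeasurableSet.empty, fun ε _ => ⟨∅, le_rfl, @MeasurableSet.empty _ (optionalSigma ℱ),
          fun ω t h => ?_, by simp⟩, fun ε _ => ⟨∅ᶜ, le_rfl, ?_, fun ω t h => by simp, by simp⟩⟩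
        · simp at h
        · exact (@MeasurableSet.empty _ (optionalSigma ℱ)).compl
      measurableSet_compl := by
        rintro B ⟨h1, h2, h3⟩
        exact ⟨h1.compl, h3, by rwa [compl_compl]⟩
      measurableSet_iUnion := by
        intro s hs
        refine ⟨MeasurableSet.iUnion fun n => (hs n).1,
          Apx.iUnion ℱ l (fun n => (hs n).1) fun n => (hs n).2.1, ?_⟩
        rw [Set.compl_iUnion]
        exact Apx.iInter ℱ l fun n => (hs n).2.2 }
  have hle : optionalSigma ℱ ≤ M := by
    refine iSup₂_le ?_
    intro X hX
    have hXo : ∀ s : Set ℝ, MeasurableSet s →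
        MeasurableSet[optionalSigma ℱ] ((fun p : ℝ≥0 × Ω => X p.1 p.2) ⁻¹' s) := by
      intro s hs
      have : MeasurableSpace.comap (fun p : ℝ≥0 × Ω => X p.1 p.2) (borel ℝ) ≤ optionalSigma ℱ :=
        le_iSup₂_of_le (f := fun (X : ℝ≥0 → Ω → ℝ) _ =>
          MeasurableSpace.comap (fun p : ℝ≥0 × Ω => X p.1 p.2) (borel ℝ)) X hX le_rfl
      refine this _ ⟨s, ?_, rfl⟩
      rwa [← BorelSpace.measurable_eq (α := ℝ)]
    have hcl : ∀ s : Set ℝ, IsClosed s → Apx ℱ l ((fun p : ℝ≥0 × Ω => X p.1 p.2) ⁻¹' s) := by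
      intro s hs ε _
      refine ⟨_, le_rfl, hXo s hs.measurableSet, ?_, by simp⟩
      intro ω t h
      exact hs.mem_of_frequently_of_tendsto h (hX.1 ω t)
    rw [borel_eq_generateFrom_isClosed, MeasurableSpace.comap_generateFrom]
    refine MeasurableSpace.generateFrom_le ?_
    rintro _ ⟨s, hs, rfl⟩
    have hs : IsClosed s := hs
    refine ⟨opt_meas ℱ (hXo s hs.measurableSet), hcl s hs, ?_⟩
    obtain ⟨F, hF, -, hFU, -⟩ := hs.isOpen_compl.exists_iUnion_isClosed
    rw [← Set.preimage_compl, ← hFU, Set.preimage_iUnion]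
    exact Apx.iUnion ℱ l (fun n => opt_meas ℱ (hXo _ (hF n).measurableSet)) fun n => hcl _ (hF n)
  exact (hle _ hB).2.1

theorem stop_of_lt {Ω : Type*} [mΩ : MeasurableSpace Ω] (μ : Measure Ω)
    (ℱ : Filtration ℝ≥0 mΩ) (hUC : UsualConditions μ ℱ) (T : Ω → ℝ≥0∞)
    (h : ∀ t : ℝ≥0, MeasurableSet[ℱ t] {ω | T ω < (t : ℝ≥0∞)}) : IsStopTime ℱ T := by
  intro t
  rw [hUC.1 t, MeasurableSpace.measurableSet_iInf]
  intro s
  rw [MeasurableSpace.measurableSet_iInf]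
  intro hts
  have : {ω | T ω ≤ (t : ℝ≥0∞)} =
      ⋂ n : ℕ, {ω | T ω < ((min s (t + 1 / ((n : ℝ≥0) + 1)) : ℝ≥0) : ℝ≥0∞)} := by
    ext ω
    simp only [Set.mem_ofPred_eq, Set.mem_iInter]
    constructor
    · intro hω n
      refine hω.trans_lt ?_
      rw [ENNReal.coe_lt_coe]
      exact lt_min hts (lt_add_of_pos_right _ (by positivity))
    · intro hω
      have hlim : Tendsto (fun n : ℕ => ((t + 1 / ((n : ℝ≥0) + 1) : ℝ≥0) : ℝ≥0∞)) atTop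
          (nhds (t : ℝ≥0∞)) := by
        rw [ENNReal.tendsto_coe]
        have := (tendsto_one_div_add_atTop_nhds_zero_nat (𝕜 := ℝ≥0)).const_add t
        simpa using this
      refine ge_of_tendsto' hlim fun n => (hω n).le.trans ?_
      rw [ENNReal.coe_le_coe]
      exact min_le_right _ _
  rw [this]
  exact MeasurableSet.iInter fun n => ℱ.mono (min_le_left _ _) _ (h _)

theorem debut_section {Ω : Type*} [mΩ : MeasurableSpace Ω] (μ : Measure Ω) [IsFiniteMeasure μ]
    (ℱ : Filtration ℝ≥0 mΩ) (hUC : UsualConditions μ ℱ) {K : Set (ℝ≥0 × Ω)}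
    (hK : MeasurableSet[optionalSigma ℱ] K) (hRC : RC K) :
    ∃ T : Ω → ℝ≥0∞, IsStopTime ℱ T ∧ (∀ ω, T ω < ∞ → ((T ω).toNNReal, ω) ∈ K) ∧
      μ (Prod.snd '' K \ {ω | T ω < ∞}) = 0 := by
  classical
  let q : ℕ → ℝ≥0 := TopologicalSpace.denseSeq ℝ≥0
  have hq : ∀ a b : ℝ≥0, a < b → ∃ n, a < q n ∧ q n < b := by
    intro a b hab
    have hd : Dense (Set.range (TopologicalSpace.denseSeq ℝ≥0)) :=
      TopologicalSpace.denseRange_denseSeq ℝ≥0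
    obtain ⟨_, ⟨n, rfl⟩, h1, h2⟩ := hd.exists_between hab
    exact ⟨n, h1, h2⟩
  choose E hE hEH hE0 using fun n => meas_proj (ℱ (q n)) μ (ℱ.le (q n)) (opt_prog ℱ (q n) hK)
  let N : Set Ω := toMeasurable μ (⋃ n, (Prod.snd '' (K ∩ {p | p.1 < q n})) \ E n)
  have hN0 : μ N = 0 := by
    rw [measure_toMeasurable]
    exact measure_iUnion_null hE0
  have hNsub : ∀ n, (Prod.snd '' (K ∩ {p | p.1 < q n})) \ E n ⊆ N := fun n =>
    (Set.subset_iUnion (fun n => (Prod.snd '' (K ∩ {p | p.1 < q n})) \ E n) n).trans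
      (subset_toMeasurable _ _)
  have hN : MeasurableSet[ℱ 0] N := hUC.2 N (measurableSet_toMeasurable _ _) hN0
  let F : Ω → Set ℝ≥0 := fun ω => {s | (s, ω) ∈ K}
  have hF : ∀ ω, (F ω).Nonempty → sInf (F ω) ∈ F ω := by
    intro ω hne
    have hglb : IsGLB (F ω) (sInf (F ω)) := isGLB_csInf hne (OrderBot.bddBelow _)
    exact hRC ω _ (hglb.frequently_mem hne)
  let T : Ω → ℝ≥0∞ := fun ω =>
    if ω ∉ N ∧ (F ω).Nonempty then ((sInf (F ω) : ℝ≥0) : ℝ≥0∞) else ∞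
  have hT : ∀ ω, T ω < ∞ ↔ ω ∉ N ∧ (F ω).Nonempty := by
    intro ω
    by_cases h : ω ∉ N ∧ (F ω).Nonempty
    · simp only [T, if_pos h, ENNReal.coe_lt_top, h, true_iff]
      exact ⟨not_false, trivial⟩
    · simp only [T, if_neg h, lt_irrefl, h]
  refine ⟨T, stop_of_lt μ ℱ hUC T ?_, ?_, ?_⟩
  · intro t
    have : {ω | T ω < (t : ℝ≥0∞)} = (⋃ n ∈ {n | q n < t}, E n) \ N := by
      ext ω
      simp only [Set.mem_ofPred_eq, Set.mem_sdiff, Set.mem_iUnion, exists_prop]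
      constructor
      · intro h
        have h' := (hT ω).1 (h.trans ENNReal.coe_lt_top)
        simp only [T, if_pos h', ENNReal.coe_lt_coe] at h
        obtain ⟨n, h1, h2⟩ := hq _ _ h
        refine ⟨⟨n, h2, ?_⟩, h'.1⟩
        by_contra h3
        exact h'.1 (hNsub n ⟨⟨(_, ω), ⟨hF ω h'.2, h1⟩, rfl⟩, h3⟩)
      · rintro ⟨⟨n, h2, h3⟩, h4⟩
        obtain ⟨⟨s, ω'⟩, ⟨h5, h6⟩, rfl⟩ := hEH n h3
        have h' : ω' ∉ N ∧ (F ω').Nonempty := ⟨h4, s, h5⟩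
        simp only [T]
        rw [if_pos h', ENNReal.coe_lt_coe]
        exact (csInf_le (OrderBot.bddBelow (F ω')) (show s ∈ F ω' from h5)).trans_lt
          (lt_trans h6 h2)
    rw [this]
    refine MeasurableSet.diff ?_ (ℱ.mono (bot_le : (0 : ℝ≥0) ≤ t) _ hN)
    exact MeasurableSet.biUnion (Set.to_countable _) fun n hn => ℱ.mono (le_of_lt hn) _ (hE n)
  · intro ω hω
    have h' := (hT ω).1 hω
    simp only [T, if_pos h', ENNReal.toNNReal_coe]
    exact hF ω h'.2
  · refine measure_mono_null ?_ hN0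
    rintro ω ⟨⟨⟨s, ω'⟩, h1, rfl⟩, h2⟩
    by_contra h3
    exact h2 ((hT _).2 ⟨h3, s, h1⟩)

theorem opt_section {Ω : Type*} [mΩ : MeasurableSpace Ω] (μ : Measure Ω) [IsFiniteMeasure μ]
    (ℱ : Filtration ℝ≥0 mΩ) (hUC : UsualConditions μ ℱ) {A : Set (ℝ≥0 × Ω)}
    (hA : MeasurableSet[optionalSigma ℱ] A) (h0 : μ (Prod.snd '' A) ≠ 0) :
    ∃ T : Ω → ℝ≥0∞, IsStopTime ℱ T ∧ (∀ ω, T ω < ∞ → ((T ω).toNNReal, ω) ∈ A) ∧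
      μ {ω | T ω < ∞} ≠ 0 := by
  obtain ⟨c, hc0, hc⟩ := exists_between (pos_iff_ne_zero.2 h0)
  obtain ⟨R, hR, hRA, hcR⟩ := meas_section mΩ μ le_rfl (opt_meas ℱ hA) hc
  let g : Ω → ℝ≥0 × Ω := fun ω => ((R ω).toNNReal, ω)
  have hg : Measurable g := hR.ennreal_toNNReal.prodMk measurable_id
  let l : Measure (ℝ≥0 × Ω) := (μ.restrict {ω | R ω < ∞}).map g
  have hRm : MeasurableSet {ω | R ω < ∞} := hR measurableSet_Iio
  have hlA : c ≤ l A := by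
    rw [Measure.map_apply hg (opt_meas ℱ hA), Measure.restrict_apply (hg (opt_meas ℱ hA))]
    refine hcR.trans (measure_mono fun ω hω => ⟨hRA ω hω, hω⟩)
  obtain ⟨ε, hε0, hεc⟩ := exists_between hc0
  obtain ⟨K, hKA, hK, hRC, hlK⟩ := opt_apx ℱ l hA ε hε0.ne'
  obtain ⟨T, hT, hTK, hT0⟩ := debut_section μ ℱ hUC hK hRC
  refine ⟨T, hT, fun ω hω => hKA (hTK ω hω), fun h => ?_⟩
  have h1 : μ (Prod.snd '' K) = 0 := by
    refine measure_mono_null ?_ (measure_union_null hT0 h)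
    intro ω hω
    by_cases h2 : T ω < ∞
    · exact Or.inr h2
    · exact Or.inl ⟨hω, h2⟩
  have h2 : l K = 0 := by
    rw [Measure.map_apply hg (opt_meas ℱ hK), Measure.restrict_apply (hg (opt_meas ℱ hK))]
    refine measure_mono_null ?_ h1
    rintro ω ⟨h3, -⟩
    exact ⟨_, h3, rfl⟩
  have h3 : l A ≤ l K + l (A \ K) := by
    refine (measure_mono ?_).trans (measure_union_le _ _)
    intro p hp
    by_cases h : p ∈ K
    · exact Or.inl h
    · exact Or.inr ⟨hp, h⟩
  rw [h2, zero_add] at h3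
  exact absurd (hlA.trans (h3.trans hlK)) hεc.not_ge

theorem gce_aux {Ω : Type*} (G : MeasurableSpace Ω) {mΩ : MeasurableSpace Ω} (μ : Measure Ω)
    [IsFiniteMeasure μ] (hG : G ≤ mΩ) {ξ η : Ω → ℝ} (h : IsGCE μ G ξ η) {B : Set Ω}
    (hB : MeasurableSet[G] B) (hi : Integrable (B.indicator ξ) μ) :
    ∀ᵐ ω ∂μ, ω ∈ B → η ω = (μ[B.indicator ξ | G]) ω := by
  have hη : Measurable[mΩ] η := h.1.mono hG le_rfl
  have key : ∀ m : ℕ, ∀ᵐ ω ∂μ, ω ∈ B → |η ω| ≤ m → η ω = (μ[B.indicator ξ | G]) ω := by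
    intro m
    let C : Set Ω := {ω | |η ω| ≤ m}
    have hC : MeasurableSet[G] C := by
      have : C = η ⁻¹' (Set.Icc (-m : ℝ) m) := by
        ext ω
        exact abs_le (a := η ω) (b := (m : ℝ))
      rw [this]
      exact h.1 measurableSet_Icc
    have hint : ∀ D : Set Ω, MeasurableSet[G] D → Integrable ((D ∩ B).indicator ξ) μ := by
      intro D hD
      rw [← Set.indicator_indicator]
      exact hi.indicator (hG _ hD)
    have hCi : Integrable ((B ∩ C).indicator η) μ := by
      refine Integrable.of_bound (C := m) ((hη.indicator
        (hG _ (hB.inter hC))).aestronglyMeasurable) (Eventually.of_forall fun ω => ?_)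
      by_cases hω : ω ∈ B ∩ C
      · rw [Set.indicator_of_mem hω]
        exact hω.2
      · rw [Set.indicator_of_notMem hω]
        simp
    have h1 : (B ∩ C).indicator η =ᵐ[μ] μ[C.indicator (B.indicator ξ) | G] := by
      refine ae_eq_condExp_of_forall_setIntegral_eq hG (hi.indicator (hG _ hC))
        (fun s _ _ => hCi.integrableOn) ?_ ?_
      · intro s hs _
        have hD : MeasurableSet[G] (s ∩ C) := hs.inter hC
        have h2 := h.2 _ (hD.inter hB) (hint _ hD)
        rw [← integral_indicator (hG _ hs), ← integral_indicator (hG _ hs)]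
        simp only [Set.indicator_indicator]
        rw [← Set.inter_assoc s C B, h2, Set.inter_comm B C, Set.inter_assoc]
      · exact ((h.1.indicator (hB.inter hC)).stronglyMeasurable).aestronglyMeasurable
    have h2 := condExp_indicator (m := G) hi hC
    filter_upwards [h1, h2] with ω h3 h4 hωB hωC
    have hωC' : ω ∈ C := hωC
    have hBC : ω ∈ B ∩ C := ⟨hωB, hωC'⟩
    rw [h4, Set.indicator_of_mem hωC', Set.indicator_of_mem hBC] at h3
    exact h3
  filter_upwards [ae_all_iff.2 key] with ω hω hB
  obtain ⟨m, hm⟩ := exists_nat_ge |η ω|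
  exact hω m hB hm

theorem gce_mul {Ω : Type*} (G : MeasurableSpace Ω) {mΩ : MeasurableSpace Ω} (μ : Measure Ω)
    [IsFiniteMeasure μ] (hG : G ≤ mΩ) {ξ ζ z w u : Ω → ℝ} (hz : Measurable[G] z)
    (hζ : z =ᵐ[μ] ζ) (hw : IsGCE μ G ξ w) (hu : IsGCE μ G (fun ω => ξ ω * ζ ω) u)
    (h1 : SigmaIntegrable μ G ξ) (h2 : SigmaIntegrable μ G (fun ω => ξ ω * ζ ω)) :
    ∀ᵐ ω ∂μ, u ω = w ω * z ω := by
  obtain ⟨s, hs, hsm, hsU, hsi⟩ := h1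
  obtain ⟨r, hr, hrm, hrU, hri⟩ := h2
  have key : ∀ n : ℕ, ∀ᵐ ω ∂μ, ω ∈ s n ∩ r n → u ω = w ω * z ω := by
    intro n
    have hB : MeasurableSet[G] (s n ∩ r n) := (hs n).inter (hr n)
    have i1 : Integrable ((s n ∩ r n).indicator ξ) μ := by
      rw [Set.inter_comm, ← Set.indicator_indicator]
      exact (hsi n).indicator (hG _ (hr n))
    have i2 : Integrable ((s n ∩ r n).indicator (fun ω => ξ ω * ζ ω)) μ := by
      rw [← Set.indicator_indicator]
      exact (hri n).indicator (hG _ (hs n))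
    have e : (s n ∩ r n).indicator (fun ω => ξ ω * ζ ω) =ᵐ[μ]
        (s n ∩ r n).indicator ξ * z := by
      filter_upwards [hζ] with ω hω
      by_cases h : ω ∈ s n ∩ r n <;> simp [h, hω]
    have e2 := condExp_congr_ae (m := G) e
    have e3 := condExp_mul_of_stronglyMeasurable_right (m := G) hz.stronglyMeasurable
      (i2.congr e) i1
    filter_upwards [gce_aux G μ hG hw hB i1, gce_aux G μ hG hu hB i2, e2, e3] with ω a b c d hω
    rw [b hω, c, d, Pi.mul_apply, a hω]
  filter_upwards [ae_all_iff.2 key] with ω hω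
  obtain ⟨a, ha⟩ := Set.mem_iUnion.1 (hsU ▸ Set.mem_univ ω)
  obtain ⟨b, hb⟩ := Set.mem_iUnion.1 (hrU ▸ Set.mem_univ ω)
  exact hω (max a b) ⟨hsm (le_max_left _ _) ha, hrm (le_max_right _ _) hb⟩

/-- The optional projection operator is an averaging operator on `L_op`:
`^o(Y · ^oX) = (^oY) · (^oX)` up to indistinguishability. -/
theorem optionalProjection_averaging
    {Ω : Type*} [mΩ : MeasurableSpace Ω] (μ : Measure Ω) [IsProbabilityMeasure μ]
    (ℱ : Filtration ℝ≥0 mΩ) (hUC : UsualConditions μ ℱ)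
    (X Y Z W U : ℝ≥0 → Ω → ℝ)
    (hX : MemLop μ ℱ X) (hY : MemLop μ ℱ Y)
    (hZ : IsOptProj μ ℱ X Z) (hW : IsOptProj μ ℱ Y W)
    (hM : MemLop μ ℱ fun t ω => Y t ω * Z t ω)
    (hU : IsOptProj μ ℱ (fun t ω => Y t ω * Z t ω) U) :
    Indist μ U fun t ω => W t ω * Z t ω := by
  by_contra hne
  have hopt : Measurable[optionalSigma ℱ] fun p : ℝ≥0 × Ω =>
      U p.1 p.2 - W p.1 p.2 * Z p.1 p.2 := hU.1.sub (hW.1.mul hZ.1)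
  have hA : MeasurableSet[optionalSigma ℱ]
      ((fun p : ℝ≥0 × Ω => U p.1 p.2 - W p.1 p.2 * Z p.1 p.2) ⁻¹' {0}ᶜ) :=
    hopt (measurableSet_singleton 0).compl
  have h0 : μ (Prod.snd ''
      ((fun p : ℝ≥0 × Ω => U p.1 p.2 - W p.1 p.2 * Z p.1 p.2) ⁻¹' {0}ᶜ)) ≠ 0 := by
    intro h0
    apply hne
    refine measure_mono_null ?_ h0
    intro ω hω
    have hω' : ¬ ∀ t, U t ω = W t ω * Z t ω := hω
    push Not at hω'
    obtain ⟨t, ht⟩ := hω'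
    exact ⟨(t, ω), fun h => ht (sub_eq_zero.1 h), rfl⟩
  obtain ⟨T, hT, hTA, hT0⟩ := opt_section μ ℱ hUC hA h0
  obtain ⟨z, hz, hz'⟩ := hZ.2 T hT
  obtain ⟨w, hw, hw'⟩ := hW.2 T hT
  obtain ⟨u, hu, hu'⟩ := hU.2 T hT
  have hG : sigmaAt ℱ T hT ≤ mΩ := fun A hA => (iSup_le fun t => ℱ.le t) _ hA.1
  have hmul : stoppedVal (fun t ω => Y t ω * Z t ω) T =
      fun ω => stoppedVal Y T ω * stoppedVal Z T ω := by
    funext ω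
    by_cases h : T ω < ∞ <;> simp [stoppedVal, h]
  have hi2 := hM.2 T hT
  rw [hmul] at hu hi2
  have hfin := gce_mul (sigmaAt ℱ T hT) μ hG hz.1 hz' hw hu (hY.2 T hT) hi2
  apply hT0
  refine measure_mono_null ?_ (ae_iff.1 (hfin.and (hz'.and (hw'.and hu'))))
  rintro ω hω ⟨h1, h2, h3, h4⟩
  have hω' : T ω < ∞ := hω
  rw [h2, h3, h4] at h1
  simp only [stoppedVal, Set.indicator, Set.mem_ofPred_eq, hω', if_true] at h1
  exact hTA ω hω' (sub_eq_zero.2 h1)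

end
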